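/- Let 1 ≤ d < n be integers, α₀ ∈ ℝ^{n−d}, A ∈ ℝ^{d×(n−d)}, and let Ã ∈ ℝ^{(d+1)×(n−d)} be the matrix with first row α₀ and remaining rows A. Suppose the multiplicative diophantine type satisfies ω(A) < dn. Then for every approximation function ψ: ℕ → ℝ_{≥0} (not necessarily monotone) with ∑_{q=1}^∞ ψ(q)^n < ∞, the set {x ∈ ℝ^d : there exist infinitely many q ∈ ℕ with max(‖qx‖, ‖q·((1,x)·Ã)‖) < ψ(q)} has d-dimensional Lebesgue measure zero. (That is, the affine subspace H = {(x, (1,x)·Ã) : x ∈ ℝ^d} is of strong Khintchine type for convergence.) -/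

import Mathlib

open MeasureTheory
open scoped ENNReal NNReal

/-- Distance to the nearest integer. -/
noncomputable def dNI (y : ℝ) : ℝ := |y - round y|

/-- Supremum norm of an integer vector, as a natural number. -/
def jnorm {m : ℕ} (j : Fin m → ℤ) : ℕ := Finset.univ.sup fun i => (j i).natAbs

/-- The multiplicative diophantine type `ω(M)` of a matrix `M ∈ ℝ^{l×m}`:
the least upper bound of all `ω > 0` such that
`∏_{u=1}^l ‖j ⬝ row_u M‖ < |j|^{-ω}` has infinitely many solutions `j ∈ ℤ^m`. -/
noncomputable def multType {l m : ℕ} (M : Matrix (Fin l) (Fin m) ℝ) : ℝ≥0∞ :=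
  sSup {w : ℝ≥0∞ | ∃ ω : ℝ, 0 < ω ∧ w = ENNReal.ofReal ω ∧
    {j : Fin m → ℤ | j ≠ 0 ∧
      (∏ u, dNI (∑ v, (j v : ℝ) * M u v)) < (jnorm j : ℝ) ^ (-ω)}.Infinite}

lemma dNI_nonneg (y : ℝ) : 0 ≤ dNI y := abs_nonneg _

lemma dNI_le_half (y : ℝ) : dNI y ≤ 1 / 2 := abs_sub_round y

lemma dNI_le_abs_sub_int (y : ℝ) (z : ℤ) : dNI y ≤ |y - z| := round_le y z

/-- The additive character `t ↦ exp (2πit)`. -/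
noncomputable def expChar (t : ℝ) : ℂ := Complex.exp ((2 * Real.pi * t : ℝ) * Complex.I)

lemma expChar_zero : expChar 0 = 1 := by simp [expChar]

lemma expChar_add (s t : ℝ) : expChar (s + t) = expChar s * expChar t := by
  rw [expChar, expChar, expChar, ← Complex.exp_add]
  congr 1
  push_cast
  ring

lemma expChar_sum {ι : Type*} (s : Finset ι) (f : ι → ℝ) :
    expChar (∑ i ∈ s, f i) = ∏ i ∈ s, expChar (f i) := by
  classical
  induction s using Finset.induction_on with
  | empty => simp [expChar_zero]
  | insert a s ha ih => rw [Finset.sum_insert ha, Finset.prod_insert ha, expChar_add, ih]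

lemma norm_expChar (t : ℝ) : ‖expChar t‖ = 1 := Complex.norm_exp_ofReal_mul_I _

lemma expChar_nat_mul (k : ℕ) (t : ℝ) : expChar (k * t) = expChar t ^ k := by
  rw [expChar, expChar, ← Complex.exp_nat_mul]
  congr 1
  push_cast
  ring

lemma expChar_int (z : ℤ) : expChar z = 1 := by
  rw [expChar, Complex.exp_eq_one_iff]
  exact ⟨z, by push_cast; ring⟩

lemma expChar_sub_round (t : ℝ) : expChar (t - round t) = expChar t := by
  have h := expChar_add (t - round t) (round t)
  rw [sub_add_cancel, expChar_int, mul_one] at h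
  exact h.symm

lemma conj_expChar (t : ℝ) : (starRingEnd ℂ) (expChar t) = expChar (-t) := by
  rw [expChar, expChar, ← Complex.exp_conj, map_mul, Complex.conj_ofReal, Complex.conj_I]
  congr 1
  push_cast
  ring

lemma half_le_norm_sum_expChar {K : ℕ} {y : ℝ} (h : dNI y * K ≤ 1 / 6) :
    (K : ℝ) / 2 ≤ ‖∑ k : Fin K, expChar ((k : ℕ) * y)‖ := by
  refine le_trans ?_ (Complex.re_le_norm _)
  rw [Complex.re_sum]
  have key : ∀ k : Fin K, (1 / 2 : ℝ) ≤ (expChar ((k : ℕ) * y)).re := by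
    intro k
    rw [expChar_nat_mul, ← expChar_sub_round, ← expChar_nat_mul, expChar,
      Complex.exp_ofReal_mul_I_re, ← Real.cos_pi_div_three, ← Real.cos_abs (2 * Real.pi * _)]
    have hk : ((k : ℕ) : ℝ) ≤ K := by exact_mod_cast k.2.le
    have h1 : |2 * Real.pi * (((k : ℕ) : ℝ) * (y - round y))| ≤ Real.pi / 3 := by
      rw [abs_mul, abs_of_pos (by positivity : (0 : ℝ) < 2 * Real.pi), abs_mul, Nat.abs_cast]
      have h2 : ((k : ℕ) : ℝ) * |y - round y| ≤ 1 / 6 :=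
        le_trans (by rw [mul_comm (dNI y)]; exact mul_le_mul_of_nonneg_right hk (dNI_nonneg y)) h
      nlinarith [Real.pi_pos]
    exact Real.cos_le_cos_of_nonneg_of_le_pi (abs_nonneg _) (by linarith [Real.pi_pos]) h1
  calc (K : ℝ) / 2 = ∑ _k : Fin K, (1 / 2 : ℝ) := by simp; ring
    _ ≤ _ := Finset.sum_le_sum fun k _ => key k

lemma norm_sum_expChar_mul_dNI_le (L : ℕ) (t : ℝ) :
    ‖∑ a : Fin L, expChar ((a : ℕ) * t)‖ * dNI t ≤ 1 := by
  have hgeom := geom_sum_mul (expChar t) L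
  have hsum : ∑ a : Fin L, expChar ((a : ℕ) * t) = ∑ i ∈ Finset.range L, expChar t ^ i := by
    rw [← Fin.sum_univ_eq_sum_range (fun i => expChar t ^ i)]
    simp only [expChar_nat_mul]
  rw [hsum]
  have h1 : ‖expChar t ^ L - 1‖ ≤ 2 := by
    refine (norm_sub_le _ _).trans ?_
    rw [norm_pow, norm_expChar]
    norm_num
  have h2 : 4 * dNI t ≤ ‖expChar t - 1‖ := by
    rw [← expChar_sub_round, expChar, mul_comm _ Complex.I, Complex.norm_exp_I_mul_ofReal_sub_one,
      norm_mul, Real.norm_eq_abs, Real.norm_eq_abs]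
    have h3 : |2 * Real.pi * (t - round t) / 2| = Real.pi * dNI t := by
      rw [show 2 * Real.pi * (t - round t) / 2 = Real.pi * (t - round t) by ring, abs_mul,
        abs_of_pos Real.pi_pos, dNI]
    have h4 := Real.mul_abs_le_abs_sin (x := 2 * Real.pi * (t - round t) / 2)
      (by rw [h3]; nlinarith [Real.pi_pos, dNI_le_half t])
    rw [h3] at h4
    have h5 : 2 / Real.pi * (Real.pi * dNI t) = 2 * dNI t := by
      field_simp
    rw [h5] at h4
    rw [abs_of_pos (by norm_num : (0 : ℝ) < 2)]
    linarith
  have h6 : ‖∑ i ∈ Finset.range L, expChar t ^ i‖ * ‖expChar t - 1‖ ≤ 2 := by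
    rw [← norm_mul, hgeom]; exact h1
  nlinarith [norm_nonneg (∑ i ∈ Finset.range L, expChar t ^ i)]

/-- The modulus of the exponential sum over a box of side `L` with frequency vector `j A`. -/
noncomputable def boxSum {d m : ℕ} (A : Matrix (Fin d) (Fin m) ℝ) (L : ℕ) (j : Fin m → ℤ) : ℝ :=
  ∏ u, ‖∑ a : Fin L, expChar ((a : ℕ) * ∑ v, (j v : ℝ) * A u v)‖

lemma boxSum_nonneg {d m : ℕ} (A : Matrix (Fin d) (Fin m) ℝ) (L : ℕ) (j : Fin m → ℤ) :
    0 ≤ boxSum A L j := Finset.prod_nonneg fun _ _ => norm_nonneg _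

lemma boxSum_zero {d m : ℕ} (A : Matrix (Fin d) (Fin m) ℝ) (L : ℕ) :
    boxSum A L 0 = (L : ℝ) ^ d := by
  simp [boxSum, expChar_zero]

lemma boxSum_le_inv {d m : ℕ} (A : Matrix (Fin d) (Fin m) ℝ) (L : ℕ) (j : Fin m → ℤ)
    (hj : ∀ u, 0 < dNI (∑ v, (j v : ℝ) * A u v)) :
    boxSum A L j ≤ ∏ u, (dNI (∑ v, (j v : ℝ) * A u v))⁻¹ := by
  refine Finset.prod_le_prod (fun _ _ => norm_nonneg _) fun u _ => ?_
  rw [← one_div, le_div_iff₀ (hj u)]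
  exact norm_sum_expChar_mul_dNI_le L _

lemma norm_sum_expChar_affine {d m : ℕ} (A : Matrix (Fin d) (Fin m) ℝ) (β : Fin m → ℝ) (L : ℕ)
    (j : Fin m → ℤ) :
    ‖∑ i : Fin d → Fin L, expChar (∑ v, (j v : ℝ) * (β v + ∑ u, ((i u : ℕ) : ℝ) * A u v))‖
      = boxSum A L j := by
  have h : ∀ i : Fin d → Fin L,
      expChar (∑ v, (j v : ℝ) * (β v + ∑ u, ((i u : ℕ) : ℝ) * A u v)) =
        expChar (∑ v, (j v : ℝ) * β v) *
          ∏ u, expChar (((i u : ℕ) : ℝ) * ∑ v, (j v : ℝ) * A u v) := by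
    intro i
    rw [← expChar_sum, ← expChar_add]
    congr 1
    simp only [mul_add, Finset.sum_add_distrib, Finset.mul_sum]
    rw [Finset.sum_comm]
    congr 1
    exact Finset.sum_congr rfl fun u _ => Finset.sum_congr rfl fun v _ => by ring
  simp only [h]
  rw [← Finset.mul_sum, norm_mul, norm_expChar, one_mul, boxSum, ← norm_prod,
    Finset.prod_univ_sum, Fintype.piFinset_univ]

/-- The integer vectors of supremum norm at most `K`. -/
noncomputable def intBox (m K : ℕ) : Finset (Fin m → ℤ) :=
  Fintype.piFinset fun _ => Finset.Icc (-(K : ℤ)) K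

lemma mem_intBox {m K : ℕ} {j : Fin m → ℤ} : j ∈ intBox m K ↔ ∀ v, |j v| ≤ K := by
  simp [intBox, abs_le]

lemma norm_sq_sum_expChar {m K : ℕ} (y : Fin m → ℝ) :
    ((∏ v, ‖∑ k : Fin K, expChar ((k : ℕ) * y v)‖ ^ 2 : ℝ) : ℂ) =
      ∑ k : Fin m → Fin K, ∑ l : Fin m → Fin K,
        expChar (∑ v, (((k v : ℤ) - (l v : ℤ) : ℤ) : ℝ) * y v) := by
  have h : ∏ v, (∑ k : Fin K, expChar ((k : ℕ) * y v)) =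
      ∑ k : Fin m → Fin K, expChar (∑ v, ((k v : ℕ) : ℝ) * y v) := by
    rw [Finset.prod_univ_sum, Fintype.piFinset_univ]
    exact Finset.sum_congr rfl fun k _ => (expChar_sum _ _).symm
  rw [Finset.prod_pow, ← norm_prod, h, Complex.ofReal_pow]
  rw [← Complex.mul_conj', map_sum, Finset.sum_mul_sum]
  refine Finset.sum_congr rfl fun k _ => Finset.sum_congr rfl fun l _ => ?_
  rw [conj_expChar, ← expChar_add]
  congr 1
  rw [← sub_eq_add_neg, ← Finset.sum_sub_distrib]
  exact Finset.sum_congr rfl fun v _ => by push_cast; ring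

lemma card_near_le {d m : ℕ} (A : Matrix (Fin d) (Fin m) ℝ) (β : Fin m → ℝ) (L K : ℕ)
    (hK : 0 < K) (s : Finset (Fin d → Fin L))
    (hs : ∀ i ∈ s, ∀ v, dNI (β v + ∑ u, ((i u : ℕ) : ℝ) * A u v) * K ≤ 1 / 6) :
    (s.card : ℝ) * (K : ℝ) ^ m ≤ 4 ^ m * ∑ j ∈ intBox m K, boxSum A L j := by
  set Y : (Fin d → Fin L) → Fin m → ℝ := fun i v => β v + ∑ u, ((i u : ℕ) : ℝ) * A u v with hY
  set G : (Fin d → Fin L) → ℝ := fun i => ∏ v, ‖∑ k : Fin K, expChar ((k : ℕ) * Y i v)‖ ^ 2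
  have hlow : (s.card : ℝ) * ((K : ℝ) ^ 2 / 4) ^ m ≤ ∑ i, G i := by
    calc (s.card : ℝ) * ((K : ℝ) ^ 2 / 4) ^ m = ∑ i ∈ s, ∏ _v : Fin m, ((K : ℝ) / 2) ^ 2 := by
          simp only [Finset.prod_const, Finset.sum_const, nsmul_eq_mul, Finset.card_univ,
            Fintype.card_fin]
          congr 2
          ring
      _ ≤ ∑ i ∈ s, G i := by
          refine Finset.sum_le_sum fun i hi => Finset.prod_le_prod (fun _ _ => by positivity)
            fun v _ => ?_
          have := half_le_norm_sum_expChar (hs i hi v)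
          gcongr
      _ ≤ ∑ i, G i := Finset.sum_le_sum_of_subset_of_nonneg (Finset.subset_univ _)
          fun _ _ _ => Finset.prod_nonneg fun _ _ => by positivity
  have hup : ∑ i, G i ≤ ∑ k : Fin m → Fin K, ∑ l : Fin m → Fin K,
      boxSum A L (fun v => (k v : ℤ) - (l v : ℤ)) := by
    have h1 : ((∑ i, G i : ℝ) : ℂ) = ∑ k : Fin m → Fin K, ∑ l : Fin m → Fin K, ∑ i,
        expChar (∑ v, (((k v : ℤ) - (l v : ℤ) : ℤ) : ℝ) * Y i v) := by
      rw [Complex.ofReal_sum]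
      simp only [G, norm_sq_sum_expChar]
      rw [Finset.sum_comm]
      exact Finset.sum_congr rfl fun k _ => Finset.sum_comm
    calc ∑ i, G i ≤ ‖((∑ i, G i : ℝ) : ℂ)‖ := by
          rw [Complex.norm_real]; exact le_abs_self _
      _ ≤ _ := by
          rw [h1]
          refine (norm_sum_le _ _).trans (Finset.sum_le_sum fun k _ =>
            (norm_sum_le _ _).trans (Finset.sum_le_sum fun l _ => ?_))
          exact (norm_sum_expChar_affine A β L fun v => (k v : ℤ) - (l v : ℤ)).le
  have hbox : ∀ l : Fin m → Fin K, ∑ k : Fin m → Fin K,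
      boxSum A L (fun v => (k v : ℤ) - (l v : ℤ)) ≤ ∑ j ∈ intBox m K, boxSum A L j := by
    intro l
    have hinj : Function.Injective
        (fun k : Fin m → Fin K => fun v => ((k v : ℕ) : ℤ) - ((l v : ℕ) : ℤ)) := by
      intro k k' h
      funext v
      have := congrFun h v
      simp only at this
      ext
      omega
    rw [← Finset.sum_image (f := boxSum A L) hinj.injOn]
    refine Finset.sum_le_sum_of_subset_of_nonneg ?_ fun j _ _ => boxSum_nonneg A L j
    intro j hj
    obtain ⟨k, -, rfl⟩ := Finset.mem_image.1 hj
    refine mem_intBox.2 fun v => ?_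
    have h1 := (k v).2
    have h2 := (l v).2
    rw [abs_le]
    constructor <;> omega
  rw [Finset.sum_comm] at hup
  have htot := hlow.trans (hup.trans (Finset.sum_le_sum fun l _ => hbox l))
  rw [Finset.sum_const, nsmul_eq_mul, Finset.card_univ, Fintype.card_fun, Fintype.card_fin,
    Fintype.card_fin, div_pow] at htot
  rw [Nat.cast_pow] at htot
  have hKm : (0 : ℝ) < (K : ℝ) ^ m := by positivity
  rw [← mul_le_mul_iff_right₀ hKm]
  have h4 : (0 : ℝ) < 4 ^ m := by positivity
  rw [mul_div_assoc', div_le_iff₀ h4, ← pow_mul, mul_comm 2 m, pow_mul, sq] at htot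
  linarith

lemma card_small_le {d m : ℕ} (hd : 0 < d) (A : Matrix (Fin d) (Fin m) ℝ) (K : ℕ) {η : ℝ}
    (hη : 0 < η)
    (hA : ∀ j : Fin m → ℤ, j ≠ 0 → (∀ v, |j v| ≤ 2 * (K : ℤ)) → η ≤ ∏ u, dNI (∑ v, (j v : ℝ) * A u v))
    (b : Fin d → ℝ) (hb : ∀ u, 0 < b u) (s : Finset (Fin m → ℤ))
    (hs : ∀ j ∈ s, j ≠ 0 ∧ (∀ v, |j v| ≤ (K : ℤ)) ∧ ∀ u, dNI (∑ v, (j v : ℝ) * A u v) ≤ b u) :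
    (s.card : ℝ) ≤ (2 ^ (d + 1) + 3) * ((∏ u, b u) / η) := by
  have hB : 0 < ∏ u, b u := Finset.prod_pos fun u _ => hb u
  rcases s.eq_empty_or_nonempty with rfl | ⟨j₀, hj₀⟩
  · simp only [Finset.card_empty, Nat.cast_zero]
    positivity
  have hηB : η ≤ ∏ u, b u := by
    obtain ⟨h1, h2, h3⟩ := hs j₀ hj₀
    exact (hA j₀ h1 fun v => (h2 v).trans (by omega)).trans
      (Finset.prod_le_prod (fun _ _ => dNI_nonneg _) fun u _ => h3 u)
  set M : ℕ := ⌊2 ^ d * ((∏ u, b u) / η)⌋₊ + 1 with hM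
  have hM0 : (0 : ℝ) < M := by rw [hM]; positivity
  have hMlt : 2 ^ d * ((∏ u, b u) / η) < M := by
    rw [hM]; push_cast; exact Nat.lt_floor_add_one _
  have hMle : (M : ℝ) ≤ 2 ^ d * ((∏ u, b u) / η) + 1 := by
    rw [hM]; push_cast; gcongr; exact Nat.floor_le (by positivity)
  set u₀ : Fin d := ⟨0, hd⟩
  set σ : (Fin m → ℤ) → Fin d → ℝ := fun j u =>
    (∑ v, (j v : ℝ) * A u v) - round (∑ v, (j v : ℝ) * A u v) with hσ
  have hσb : ∀ j ∈ s, ∀ u, |σ j u| ≤ b u := fun j hj u => (hs j hj).2.2 u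
  have hmaps : Set.MapsTo (fun j => ⌊σ j u₀ * (M / b u₀)⌋) s (Finset.Icc (-(M : ℤ)) M) := by
    intro j hj
    have h := abs_le.1 (hσb j hj u₀)
    have hpos : 0 < (M : ℝ) / b u₀ := div_pos hM0 (hb u₀)
    have hMb : b u₀ * ((M : ℝ) / b u₀) = M := by field_simp [(hb u₀).ne']
    rw [Finset.coe_Icc, Set.mem_Icc]
    constructor
    · rw [Int.le_floor]
      push_cast
      nlinarith
    · have : (⌊σ j u₀ * (M / b u₀)⌋ : ℝ) ≤ M := (Int.floor_le _).trans (by nlinarith)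
      exact_mod_cast this
  have hinj : Set.InjOn (fun j => ⌊σ j u₀ * (M / b u₀)⌋) s := by
    intro j hj k hk hjk
    by_contra hne
    have hlt : |σ j u₀ - σ k u₀| < b u₀ / M := by
      have h1 := Int.abs_sub_lt_one_of_floor_eq_floor hjk
      rw [← sub_mul, abs_mul, abs_of_pos (div_pos hM0 (hb u₀))] at h1
      rw [lt_div_iff₀ hM0]
      rw [mul_div_assoc', div_lt_one (hb u₀)] at h1
      exact h1
    have hdiff : ∀ u, dNI (∑ v, ((j - k) v : ℝ) * A u v) ≤ |σ j u - σ k u| := by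
      intro u
      refine (dNI_le_abs_sub_int _
        (round (∑ v, (j v : ℝ) * A u v) - round (∑ v, (k v : ℝ) * A u v))).trans (le_of_eq ?_)
      congr 1
      simp only [hσ, Pi.sub_apply, Int.cast_sub, sub_mul, Finset.sum_sub_distrib]
      ring
    have hge := hA (j - k) (sub_ne_zero.2 hne) fun v => by
      have h1 := (hs j hj).2.1 v
      have h2 := (hs k hk).2.1 v
      rw [Pi.sub_apply]
      exact (abs_sub _ _).trans (by omega)
    have hlt' : ∏ u, dNI (∑ v, ((j - k) v : ℝ) * A u v) < η := by
      rw [← Finset.mul_prod_erase _ _ (Finset.mem_univ u₀)]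
      have h1 : ∏ u ∈ Finset.univ.erase u₀, dNI (∑ v, ((j - k) v : ℝ) * A u v) ≤
          ∏ u ∈ Finset.univ.erase u₀, (2 * b u) :=
        Finset.prod_le_prod (fun _ _ => dNI_nonneg _) fun u _ => (hdiff u).trans <|
          (abs_sub _ _).trans (by linarith [hσb j hj u, hσb k hk u])
      have h2 : 0 < ∏ u ∈ Finset.univ.erase u₀, (2 * b u) :=
        Finset.prod_pos fun u _ => by linarith [hb u]
      have h3 : (2 * b u₀) * ∏ u ∈ Finset.univ.erase u₀, (2 * b u) = 2 ^ d * ∏ u, b u := by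
        rw [Finset.mul_prod_erase _ (fun u => 2 * b u) (Finset.mem_univ u₀),
          Finset.prod_mul_distrib]
        simp
      calc _ ≤ |σ j u₀ - σ k u₀| * ∏ u ∈ Finset.univ.erase u₀, (2 * b u) :=
            mul_le_mul (hdiff u₀) h1 (Finset.prod_nonneg fun _ _ => dNI_nonneg _) (abs_nonneg _)
        _ ≤ (2 * b u₀) / M * ∏ u ∈ Finset.univ.erase u₀, (2 * b u) := by
            refine mul_le_mul_of_nonneg_right (hlt.le.trans ?_) h2.le
            gcongr
            linarith [hb u₀]
        _ = 2 ^ d * (∏ u, b u) / M := by rw [div_mul_eq_mul_div, h3]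
        _ < η := by
            rw [div_lt_iff₀ hM0]
            rw [mul_div_assoc', div_lt_iff₀ hη] at hMlt
            linarith
    linarith
  have hcard := Finset.card_le_card_of_injOn _ hmaps hinj
  rw [Int.card_Icc] at hcard
  have hcard' : (s.card : ℝ) ≤ 2 * M + 1 := by
    have : s.card ≤ 2 * M + 1 := by omega
    exact_mod_cast this
  have h1 : 1 ≤ (∏ u, b u) / η := (one_le_div hη).2 hηB
  calc (s.card : ℝ) ≤ 2 * M + 1 := hcard'
    _ ≤ 2 * (2 ^ d * ((∏ u, b u) / η) + 1) + 1 := by gcongr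
    _ ≤ _ := by rw [pow_succ]; nlinarith

lemma inv_le_sum_dyadic {x η : ℝ} {T : ℕ} (hη : (1 / 2 : ℝ) ^ T ≤ η) (hx : η ≤ x) (hx1 : x ≤ 1) :
    x⁻¹ ≤ ∑ t ∈ Finset.range (T + 1), if x ≤ (1 / 2) ^ t then (2 : ℝ) * 2 ^ t else 0 := by
  have hx0 : 0 < x := lt_of_lt_of_le (by positivity) (hη.trans hx)
  obtain ⟨t, ht1, ht2⟩ := exists_nat_pow_near_of_lt_one hx0 hx1
    (by norm_num : (0 : ℝ) < 1 / 2) (by norm_num)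
  have htT : t ≤ T := by
    by_contra hlt
    have : (1 / 2 : ℝ) ^ t < (1 / 2) ^ T :=
      pow_lt_pow_right_of_lt_one₀ (by norm_num) (by norm_num) (by omega)
    linarith
  have hle : x⁻¹ ≤ 2 * 2 ^ t := by
    rw [inv_le_comm₀ hx0 (by positivity)]
    refine le_trans (le_of_eq ?_) ht1.le
    rw [one_div, inv_pow, pow_succ, mul_comm]
  refine hle.trans ?_
  have := Finset.single_le_sum
    (f := fun t => if x ≤ (1 / 2 : ℝ) ^ t then (2 : ℝ) * 2 ^ t else 0)
    (fun i _ => by split_ifs <;> positivity)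
    (Finset.mem_range.2 (by omega : t < T + 1))
  rwa [if_pos ht2] at this

lemma sum_prod_inv_dNI_le {d m : ℕ} (hd : 0 < d) (A : Matrix (Fin d) (Fin m) ℝ) (K T : ℕ) {η : ℝ}
    (hη : (1 / 2 : ℝ) ^ T ≤ η)
    (hA : ∀ j : Fin m → ℤ, j ≠ 0 → (∀ v, |j v| ≤ 2 * (K : ℤ)) → η ≤ ∏ u, dNI (∑ v, (j v : ℝ) * A u v)) :
    ∑ j ∈ (intBox m K).erase 0, ∏ u, (dNI (∑ v, (j v : ℝ) * A u v))⁻¹ ≤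
      2 ^ d * (2 ^ (d + 1) + 3) * (((T : ℝ) + 1) ^ d * η⁻¹) := by
  have hη0 : 0 < η := lt_of_lt_of_le (by positivity) hη
  set R : Finset (Fin d → ℕ) := Fintype.piFinset fun _ => Finset.range (T + 1)
  have hterm : ∀ j ∈ (intBox m K).erase 0, ∏ u, (dNI (∑ v, (j v : ℝ) * A u v))⁻¹ ≤
      ∑ t ∈ R, if ∀ u, dNI (∑ v, (j v : ℝ) * A u v) ≤ (1 / 2) ^ t u
        then ∏ u, ((2 : ℝ) * 2 ^ t u) else 0 := by
    intro j hj
    obtain ⟨hj0, hjK⟩ := Finset.mem_erase.1 hj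
    have hP := hA j hj0 fun v => (mem_intBox.1 hjK v).trans (by omega)
    have hlow : ∀ u, η ≤ dNI (∑ v, (j v : ℝ) * A u v) := by
      intro u
      refine hP.trans ?_
      rw [← Finset.mul_prod_erase _ _ (Finset.mem_univ u)]
      refine mul_le_of_le_one_right (dNI_nonneg _) (Finset.prod_le_one (fun _ _ => dNI_nonneg _)
        fun w _ => (dNI_le_half _).trans (by norm_num))
    refine (Finset.prod_le_prod (fun u _ => inv_nonneg.2 (dNI_nonneg _)) fun u _ =>
      inv_le_sum_dyadic hη (hlow u) ((dNI_le_half _).trans (by norm_num))).trans ?_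
    rw [Finset.prod_univ_sum]
    refine Finset.sum_le_sum fun t _ => ?_
    split_ifs with h
    · exact (Finset.prod_congr rfl fun u _ => if_pos (h u)).le
    · push Not at h
      obtain ⟨u, hu⟩ := h
      exact (Finset.prod_eq_zero (Finset.mem_univ u) (if_neg hu.not_ge)).le
  refine (Finset.sum_le_sum hterm).trans ?_
  rw [Finset.sum_comm]
  have hcol : ∀ t ∈ R, (∑ j ∈ (intBox m K).erase 0,
      if ∀ u, dNI (∑ v, (j v : ℝ) * A u v) ≤ (1 / 2) ^ t u
        then ∏ u, ((2 : ℝ) * 2 ^ t u) else 0) ≤ 2 ^ d * (2 ^ (d + 1) + 3) * η⁻¹ := by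
    intro t _
    rw [← Finset.sum_filter, Finset.sum_const, nsmul_eq_mul]
    have hc := card_small_le hd A K hη0 hA (fun u => (1 / 2 : ℝ) ^ t u) (fun u => by positivity)
      (((intBox m K).erase 0).filter fun j =>
        ∀ u, dNI (∑ v, (j v : ℝ) * A u v) ≤ (1 / 2) ^ t u) (by
        intro j hj
        obtain ⟨hj1, hj2⟩ := Finset.mem_filter.1 hj
        obtain ⟨hj0, hjK⟩ := Finset.mem_erase.1 hj1
        exact ⟨hj0, mem_intBox.1 hjK, hj2⟩)
    refine (mul_le_mul_of_nonneg_right hc (by positivity)).trans (le_of_eq ?_)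
    have h1 : (∏ u, (1 / 2 : ℝ) ^ t u) * ∏ u, ((2 : ℝ) * 2 ^ t u) = 2 ^ d := by
      rw [← Finset.prod_mul_distrib]
      have : ∀ u, (1 / 2 : ℝ) ^ t u * (2 * 2 ^ t u) = 2 := by
        intro u
        rw [one_div, inv_pow]
        field_simp
      rw [Finset.prod_congr rfl fun u _ => this u]
      simp
    rw [div_eq_mul_inv]
    linear_combination ((2 : ℝ) ^ (d + 1) + 3) * η⁻¹ * h1
  refine (Finset.sum_le_sum hcol).trans (le_of_eq ?_)
  rw [Finset.sum_const, nsmul_eq_mul, Fintype.card_piFinset]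
  simp only [Finset.card_range, Finset.prod_const, Finset.card_univ, Fintype.card_fin]
  push_cast
  ring

lemma exists_sum_prod_inv_dNI_le {d : ℕ} (hd : 0 < d) {ε : ℝ} (hε : 0 < ε) :
    ∃ C : ℝ, 0 < C ∧ ∀ (m : ℕ) (A : Matrix (Fin d) (Fin m) ℝ) (K : ℕ) (η : ℝ), 0 < η → η ≤ 1 →
    (∀ j : Fin m → ℤ, j ≠ 0 → (∀ v, |j v| ≤ 2 * (K : ℤ)) → η ≤ ∏ u, dNI (∑ v, (j v : ℝ) * A u v)) →
    ∑ j ∈ (intBox m K).erase 0, ∏ u, (dNI (∑ v, (j v : ℝ) * A u v))⁻¹ ≤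
      C * (η⁻¹) ^ (1 + ε) := by
  set r : ℝ := 2 ^ (ε / d) with hr
  have hd' : (0 : ℝ) < d := by exact_mod_cast hd
  have hr1 : 1 < r := Real.one_lt_rpow (by norm_num) (by positivity)
  have hr0 : 0 < r - 1 := by linarith
  refine ⟨2 ^ d * (2 ^ (d + 1) + 3) * (2 + (r - 1)⁻¹) ^ d, by positivity, ?_⟩
  intro m A K η hη hη1 hA
  obtain ⟨T, hT1, hT2⟩ := exists_nat_pow_near_of_lt_one hη hη1
    (by norm_num : (0 : ℝ) < 1 / 2) (by norm_num)
  refine (sum_prod_inv_dNI_le hd A K (T + 1) hT1.le hA).trans ?_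
  have hlin : ((T + 1 : ℕ) : ℝ) + 1 ≤ (2 + (r - 1)⁻¹) * r ^ T := by
    have hb := one_add_mul_le_pow (by linarith : (-2 : ℝ) ≤ r - 1) T
    rw [add_sub_cancel] at hb
    have hi : (r - 1)⁻¹ * (r - 1) = 1 := inv_mul_cancel₀ hr0.ne'
    have hT0 : (0 : ℝ) ≤ T := T.cast_nonneg
    have h1 : (2 + (r - 1)⁻¹) * (1 + T * (r - 1)) ≤ (2 + (r - 1)⁻¹) * r ^ T :=
      mul_le_mul_of_nonneg_left hb (by positivity)
    have h2 : (2 + (r - 1)⁻¹) * (1 + T * (r - 1)) =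
        2 + (r - 1)⁻¹ + 2 * T * (r - 1) + T * ((r - 1)⁻¹ * (r - 1)) := by ring
    rw [hi] at h2
    have h3 : 0 < (r - 1)⁻¹ := inv_pos.2 hr0
    have h4 : 0 ≤ 2 * T * (r - 1) := by positivity
    push_cast
    linarith
  have hpow : (r ^ T) ^ d ≤ (η⁻¹) ^ ε := by
    have h1 : (r ^ T) ^ d = ((2 : ℝ) ^ T) ^ ε := by
      rw [hr, ← Real.rpow_natCast, ← Real.rpow_natCast, ← Real.rpow_natCast, ← Real.rpow_mul,
        ← Real.rpow_mul, ← Real.rpow_mul]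
      · congr 1
        field_simp
      all_goals positivity
    rw [h1]
    refine Real.rpow_le_rpow (by positivity) ?_ hε.le
    rw [le_inv_comm₀ (by positivity) hη]
    simpa using hT2
  have hfin : (((T + 1 : ℕ) : ℝ) + 1) ^ d ≤ (2 + (r - 1)⁻¹) ^ d * (η⁻¹) ^ ε := by
    calc _ ≤ ((2 + (r - 1)⁻¹) * r ^ T) ^ d := by gcongr
      _ = (2 + (r - 1)⁻¹) ^ d * (r ^ T) ^ d := mul_pow _ _ _
      _ ≤ _ := by gcongr
  rw [Real.rpow_add (inv_pos.2 hη), Real.rpow_one]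
  calc _ ≤ 2 ^ d * (2 ^ (d + 1) + 3) * (((2 + (r - 1)⁻¹) ^ d * (η⁻¹) ^ ε) * η⁻¹) := by gcongr
    _ = _ := by ring

lemma natAbs_le_jnorm {m : ℕ} (j : Fin m → ℤ) (v : Fin m) : (j v).natAbs ≤ jnorm j :=
  Finset.le_sup (f := fun i => (j i).natAbs) (Finset.mem_univ v)

lemma one_le_jnorm {m : ℕ} {j : Fin m → ℤ} (hj : j ≠ 0) : 1 ≤ jnorm j := by
  obtain ⟨v, hv⟩ := Function.ne_iff.1 hj
  have := natAbs_le_jnorm j v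
  have h0 : j v ≠ 0 := hv
  omega

lemma dNI_int_mul_eq_zero {y : ℝ} (h : dNI y = 0) (k : ℤ) : dNI (k * y) = 0 := by
  refine le_antisymm ((dNI_le_abs_sub_int _ (k * round y)).trans ?_) (dNI_nonneg _)
  have : y = round y := sub_eq_zero.1 (abs_eq_zero.1 h)
  push_cast
  rw [← mul_sub, sub_eq_zero.2 this]
  simp

lemma exists_lower_bound_of_multType_lt {d m : ℕ} (A : Matrix (Fin d) (Fin m) ℝ) {N : ℕ}
    (hω : multType A < (N : ℝ≥0∞)) :
    ∃ ω c : ℝ, 0 < ω ∧ ω < N ∧ 0 < c ∧ c ≤ 1 ∧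
      ∀ j : Fin m → ℤ, j ≠ 0 → c * (jnorm j : ℝ) ^ (-ω) ≤ ∏ u, dNI (∑ v, (j v : ℝ) * A u v) := by
  obtain ⟨r, hr1, hr2⟩ := ENNReal.lt_iff_exists_nnreal_btwn.1 hω
  have hr0 : 0 < (r : ℝ) := by
    have : (0 : ℝ≥0∞) < r := lt_of_le_of_lt bot_le hr1
    exact_mod_cast this
  have hrN : (r : ℝ) < N := by
    have : r < (N : ℝ≥0) := by exact_mod_cast hr2
    exact_mod_cast this
  set P : (Fin m → ℤ) → ℝ := fun j => ∏ u, dNI (∑ v, (j v : ℝ) * A u v) with hP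
  set E : Set (Fin m → ℤ) := {j | j ≠ 0 ∧ P j < (jnorm j : ℝ) ^ (-(r : ℝ))} with hE
  have hfin : E.Finite := by
    by_contra hinf
    have : (r : ℝ≥0∞) ≤ multType A :=
      le_sSup ⟨r, hr0, (ENNReal.ofReal_coe_nnreal).symm, hinf⟩
    exact absurd hr1 this.not_gt
  have hjpos : ∀ j : Fin m → ℤ, j ≠ 0 → (0 : ℝ) < (jnorm j : ℝ) ^ (-(r : ℝ)) := by
    intro j hj
    have := one_le_jnorm hj
    positivity
  have hpos : ∀ j ≠ 0, 0 < P j := by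
    intro j hj
    refine lt_of_le_of_ne (Finset.prod_nonneg fun _ _ => dNI_nonneg _) fun h0 => ?_
    obtain ⟨u, -, hu⟩ := Finset.prod_eq_zero_iff.1 h0.symm
    have hne : ∀ k : ℕ, ((k : ℤ) + 1) • j ≠ 0 := fun k =>
      smul_ne_zero (by omega) hj
    have hmem : ∀ k : ℕ, ((k : ℤ) + 1) • j ∈ E := by
      intro k
      refine ⟨hne k, ?_⟩
      have hz : P (((k : ℤ) + 1) • j) = 0 := by
        refine Finset.prod_eq_zero (Finset.mem_univ u) ?_
        have h1 := dNI_int_mul_eq_zero hu ((k : ℤ) + 1)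
        rw [Finset.mul_sum] at h1
        convert h1 using 3 with v
        simp only [Pi.smul_apply, smul_eq_mul]
        push_cast
        ring
      rw [hz]
      exact hjpos _ (hne k)
    refine Set.infinite_of_injective_forall_mem (f := fun k : ℕ => ((k : ℤ) + 1) • j) ?_ hmem hfin
    intro k l hkl
    have := smul_left_injective ℤ hj hkl
    simpa using this
  have hmin : ∃ c : ℝ, 0 < c ∧ c ≤ 1 ∧ ∀ j ∈ E, c ≤ P j := by
    refine Set.Finite.induction_on_subset (motive := fun s _ =>
      ∃ c : ℝ, 0 < c ∧ c ≤ 1 ∧ ∀ j ∈ s, c ≤ P j) E hfin ⟨1, one_pos, le_rfl, by simp⟩ ?_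
    rintro a s ha - - ⟨c, hc0, hc1, hc⟩
    refine ⟨min c (P a), lt_min hc0 (hpos a ha.1), (min_le_left _ _).trans hc1, ?_⟩
    rintro j (rfl | hj)
    · exact min_le_right _ _
    · exact (min_le_left _ _).trans (hc j hj)
  obtain ⟨c, hc0, hc1, hc⟩ := hmin
  refine ⟨r, c, hr0, hrN, hc0, hc1, fun j hj => ?_⟩
  have hn1 : (1 : ℝ) ≤ jnorm j := by exact_mod_cast one_le_jnorm hj
  by_cases hjE : j ∈ E
  · exact (mul_le_of_le_one_right hc0.le
      (Real.rpow_le_one_of_one_le_of_nonpos hn1 (by linarith))).trans (hc j hjE)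
  · have : (jnorm j : ℝ) ^ (-(r : ℝ)) ≤ P j := by
      by_contra hlt
      exact hjE ⟨hj, not_le.1 hlt⟩
    exact (mul_le_of_le_one_left (hjpos j hj).le hc1).trans this

lemma exists_card_near_le {d m : ℕ} (hd : 0 < d) (A : Matrix (Fin d) (Fin m) ℝ) {N : ℕ}
    (hω : multType A < (N : ℝ≥0∞)) :
    ∃ ρ C : ℝ, 0 < ρ ∧ ρ < N ∧ 0 < C ∧ ∀ (β : Fin m → ℝ) (L K : ℕ), 0 < K →
      ∀ s : Finset (Fin d → Fin L),
      (∀ i ∈ s, ∀ v, dNI (β v + ∑ u, ((i u : ℕ) : ℝ) * A u v) * K ≤ 1 / 6) →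
      (s.card : ℝ) * (K : ℝ) ^ m ≤ C * ((L : ℝ) ^ d + (K : ℝ) ^ ρ) := by
  obtain ⟨ω, c, hω0, hωN, hc0, hc1, hlow⟩ := exists_lower_bound_of_multType_lt A hω
  set ε : ℝ := (N - ω) / (2 * ω) with hε
  have hε0 : 0 < ε := div_pos (by linarith) (by linarith)
  have hρ : ω * (1 + ε) = (ω + N) / 2 := by
    rw [hε]
    field_simp
    ring
  obtain ⟨C, hC0, hC⟩ := exists_sum_prod_inv_dNI_le hd hε0
  set D : ℝ := C * ((c⁻¹) ^ (1 + ε) * 2 ^ ((ω + N) / 2)) with hD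
  have hD0 : 0 < D := by positivity
  refine ⟨(ω + N) / 2, 4 ^ m * (1 + D), by linarith, by linarith, by positivity, ?_⟩
  intro β L K hK s hs
  refine (card_near_le A β L K hK s hs).trans ?_
  rw [mul_assoc]
  refine mul_le_mul_of_nonneg_left ?_ (by positivity)
  have hK1 : (1 : ℝ) ≤ K := by exact_mod_cast hK
  set η : ℝ := c * (2 * K : ℝ) ^ (-ω) with hη
  have hη0 : 0 < η := by positivity
  have hη1 : η ≤ 1 := mul_le_one₀ hc1 (by positivity)
    (Real.rpow_le_one_of_one_le_of_nonpos (by linarith) (by linarith))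
  have hA : ∀ j : Fin m → ℤ, j ≠ 0 → (∀ v, |j v| ≤ 2 * (K : ℤ)) →
      η ≤ ∏ u, dNI (∑ v, (j v : ℝ) * A u v) := by
    intro j hj hjK
    refine le_trans ?_ (hlow j hj)
    have h1 : jnorm j ≤ 2 * K := Finset.sup_le fun v _ => by
      have := abs_le.1 (hjK v)
      omega
    have h2 : (jnorm j : ℝ) ≤ 2 * K := by exact_mod_cast h1
    have h3 : (0 : ℝ) < jnorm j := by exact_mod_cast one_le_jnorm hj
    exact mul_le_mul_of_nonneg_left (Real.rpow_le_rpow_of_nonpos h3 h2 (by linarith)) hc0.le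
  have hS := hC m A K η hη0 hη1 hA
  have hηpow : (η⁻¹) ^ (1 + ε) =
      (c⁻¹) ^ (1 + ε) * 2 ^ ((ω + N) / 2) * (K : ℝ) ^ ((ω + N) / 2) := by
    rw [hη, mul_inv, Real.rpow_neg (by positivity), inv_inv,
      Real.mul_rpow (by positivity) (by positivity), ← Real.rpow_mul (by positivity), hρ,
      Real.mul_rpow (by positivity) (by positivity), mul_assoc]
  have hsmall : ∑ j ∈ (intBox m K).erase 0, boxSum A L j ≤ D * (K : ℝ) ^ ((ω + N) / 2) := by
    refine (Finset.sum_le_sum fun j hj => boxSum_le_inv A L j fun u => ?_).trans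
      (hS.trans (le_of_eq ?_))
    · obtain ⟨hj0, hjK⟩ := Finset.mem_erase.1 hj
      have hP := hη0.trans_le (hA j hj0 fun v => (mem_intBox.1 hjK v).trans (by omega))
      exact lt_of_le_of_ne (dNI_nonneg _) fun h0 =>
        hP.ne' (Finset.prod_eq_zero (Finset.mem_univ u) h0.symm)
    · rw [hηpow, hD]
      ring
  rw [← Finset.add_sum_erase _ _ (mem_intBox.2 fun v => by simp : (0 : Fin m → ℤ) ∈ intBox m K),
    boxSum_zero]
  have hL : (0 : ℝ) ≤ (L : ℝ) ^ d := by positivity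
  have hKρ : (0 : ℝ) ≤ (K : ℝ) ^ ((ω + N) / 2) := by positivity
  nlinarith [mul_nonneg hD0.le hL]

lemma dNI_le_add_abs_sub (y z : ℝ) : dNI y ≤ dNI z + |y - z| := by
  refine (dNI_le_abs_sub_int y (round z)).trans ?_
  have := abs_add_le (z - round z) (y - z)
  rwa [show z - round z + (y - z) = y - round z by ring] at this

/-- The points `x` with `‖x‖ ≤ R` for which `q` is a solution with error `δ`. -/
def approxSet {d m : ℕ} (α : Fin m → ℝ) (A : Matrix (Fin d) (Fin m) ℝ) (R q : ℕ) (δ : ℝ) :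
    Set (Fin d → ℝ) :=
  {x | (∀ u, |x u| ≤ R) ∧ (∀ u, dNI (q * x u) < δ) ∧
    ∀ v, dNI (q * (α v + ∑ u, x u * A u v)) < δ}

lemma volume_approxSet_le_pow {d m : ℕ} (α : Fin m → ℝ) (A : Matrix (Fin d) (Fin m) ℝ)
    (R q : ℕ) (δ : ℝ) : volume (approxSet α A R q δ) ≤ ENNReal.ofReal ((2 * R : ℝ) ^ d) := by
  have h := Real.volume_pi_closedBall (0 : Fin d → ℝ) (R.cast_nonneg : (0 : ℝ) ≤ R)
  rw [Fintype.card_fin] at h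
  rw [← h]
  refine measure_mono fun x hx => ?_
  rw [mem_closedBall_zero_iff, pi_norm_le_iff_of_nonneg R.cast_nonneg]
  exact hx.1

lemma volume_approxSet_le_card {d m : ℕ} (α : Fin m → ℝ) (A : Matrix (Fin d) (Fin m) ℝ)
    (R q : ℕ) (hq : 0 < q) {δ : ℝ} (hδ : 0 < δ) (K : ℕ)
    (hK : (1 + ∑ v, ∑ u, |A u v|) * δ * K ≤ 1 / 6) :
    ∃ s : Finset (Fin d → Fin (2 * ((R + 1) * q) + 1)),
      (∀ i ∈ s, ∀ v, dNI ((q * α v - ((R + 1) * q : ℕ) * ∑ u, A u v) +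
        ∑ u, ((i u : ℕ) : ℝ) * A u v) * K ≤ 1 / 6) ∧
      volume (approxSet α A R q δ) ≤ ENNReal.ofReal (s.card * (2 * (δ / q)) ^ d) := by
  classical
  set X : ℕ := (R + 1) * q with hX
  have hq0 : (0 : ℝ) < q := by exact_mod_cast hq
  refine ⟨Finset.univ.filter fun i : Fin d → Fin (2 * X + 1) => ∀ v,
    dNI ((q * α v - X * ∑ u, A u v) + ∑ u, ((i u : ℕ) : ℝ) * A u v) * K ≤ 1 / 6,
    fun i hi => (Finset.mem_filter.1 hi).2, ?_⟩
  set s := Finset.univ.filter fun i : Fin d → Fin (2 * X + 1) => ∀ v,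
    dNI ((q * α v - X * ∑ u, A u v) + ∑ u, ((i u : ℕ) : ℝ) * A u v) * K ≤ 1 / 6 with hs
  have hcover : approxSet α A R q δ ⊆
      ⋃ i ∈ s, Metric.ball (fun u => (((i u : ℕ) : ℝ) - X) / q) (δ / q) := by
    rintro x ⟨hxR, hxq, hxv⟩
    have habs : ∀ u, |round (q * x u)| ≤ (X : ℤ) := by
      intro u
      have h1 : |(q : ℝ) * x u| ≤ q * R := by
        rw [abs_mul, Nat.abs_cast]
        exact mul_le_mul_of_nonneg_left (hxR u) hq0.le
      have h2 := abs_le.1 (abs_sub_round ((q : ℝ) * x u))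
      have h3 := abs_le.1 h1
      have hq1 : (1 : ℝ) ≤ q := by exact_mod_cast hq
      have h4 : |(round ((q : ℝ) * x u) : ℝ)| ≤ X := by
        rw [hX, abs_le]
        push_cast
        constructor <;> linarith
      exact_mod_cast h4
    have hlt : ∀ u, (round (q * x u) + X).toNat < 2 * X + 1 := fun u => by
      have := abs_le.1 (habs u)
      omega
    set i : Fin d → Fin (2 * X + 1) := fun u => ⟨(round (q * x u) + X).toNat, hlt u⟩ with hi
    have hival : ∀ u, ((i u : ℕ) : ℝ) = round (q * x u) + X := by
      intro u
      have h1 : (((i u : ℕ) : ℤ)) = round (q * x u) + X :=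
        Int.toNat_of_nonneg (by have := abs_le.1 (habs u); omega)
      exact_mod_cast congrArg (Int.cast : ℤ → ℝ) h1
    refine Set.mem_iUnion₂.2 ⟨i, ?_, ?_⟩
    · refine Finset.mem_filter.2 ⟨Finset.mem_univ _, fun v => ?_⟩
      refine le_trans (mul_le_mul_of_nonneg_right ?_ K.cast_nonneg) hK
      refine (dNI_le_add_abs_sub _ (q * (α v + ∑ u, x u * A u v))).trans ?_
      have hdiff : (q * α v - X * ∑ u, A u v) + ∑ u, ((i u : ℕ) : ℝ) * A u v -
          q * (α v + ∑ u, x u * A u v) = ∑ u, (round (q * x u) - q * x u) * A u v := by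
        simp only [hival, mul_add, add_mul, sub_mul, Finset.sum_add_distrib,
          Finset.sum_sub_distrib, Finset.mul_sum, mul_assoc]
        ring
      rw [hdiff]
      have h1 : |∑ u, (round (q * x u) - q * x u) * A u v| ≤ δ * ∑ u, |A u v| := by
        rw [Finset.mul_sum]
        refine (Finset.abs_sum_le_sum_abs _ _).trans (Finset.sum_le_sum fun u _ => ?_)
        rw [abs_mul, abs_sub_comm]
        exact mul_le_mul_of_nonneg_right (hxq u).le (abs_nonneg _)
      have h2 : ∑ u, |A u v| ≤ ∑ v, ∑ u, |A u v| :=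
        Finset.single_le_sum (f := fun v => ∑ u, |A u v|)
          (fun v _ => Finset.sum_nonneg fun u _ => abs_nonneg _) (Finset.mem_univ v)
      have h3 := mul_le_mul_of_nonneg_left h2 hδ.le
      linarith [hxv v]
    · rw [Metric.mem_ball, dist_pi_lt_iff (by positivity)]
      intro u
      rw [hival, Real.dist_eq, lt_div_iff₀ hq0, ← abs_of_pos hq0, ← abs_mul, abs_of_pos hq0]
      have h1 := hxq u
      rw [dNI] at h1
      rwa [sub_mul, add_sub_cancel_right, div_mul_cancel₀ _ hq0.ne', mul_comm (x u)]
  refine (measure_mono hcover).trans ((measure_biUnion_finset_le _ _).trans (le_of_eq ?_))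
  rw [Finset.sum_congr rfl fun i _ => Real.volume_pi_ball _ (by positivity : 0 < δ / (q : ℝ)),
    Finset.sum_const, nsmul_eq_mul, Fintype.card_fin, ENNReal.ofReal_mul (by positivity),
    ENNReal.ofReal_natCast]

lemma exists_volume_approxSet_le {d m : ℕ} (hd : 0 < d) (α : Fin m → ℝ)
    (A : Matrix (Fin d) (Fin m) ℝ) {N : ℕ} (hω : multType A < (N : ℝ≥0∞)) (R : ℕ) :
    ∃ ρ C : ℝ, 0 < ρ ∧ ρ < N ∧ 0 ≤ C ∧ ∀ (q : ℕ) (δ : ℝ), 0 < q →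
      (q : ℝ) ^ (-((d : ℝ) / ρ)) ≤ δ →
      volume (approxSet α A R q δ) ≤ ENNReal.ofReal (C * δ ^ (d + m)) := by
  obtain ⟨ρ, C, hρ0, hρN, hC0, hC⟩ := exists_card_near_le hd A hω
  set κ : ℝ := 1 + ∑ v, ∑ u, |A u v| with hκ
  have hκ1 : 1 ≤ κ := by
    have : 0 ≤ ∑ v, ∑ u, |A u v| :=
      Finset.sum_nonneg fun v _ => Finset.sum_nonneg fun u _ => abs_nonneg _
    linarith
  set C₁ : ℝ := C * ((2 * R + 3) ^ d + 1) * (12 * κ) ^ m * 2 ^ d with hC₁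
  set C₂ : ℝ := (2 * R) ^ d * (6 * κ) ^ (d + m) with hC₂
  have hC₁0 : 0 ≤ C₁ := by positivity
  have hC₂0 : 0 ≤ C₂ := by positivity
  refine ⟨ρ, C₁ + C₂, hρ0, hρN, by positivity, fun q δ hq hδ => ?_⟩
  have hq0 : (0 : ℝ) < q := by exact_mod_cast hq
  have hq1 : (1 : ℝ) ≤ q := by exact_mod_cast hq
  have hδ0 : 0 < δ := lt_of_lt_of_le (by positivity) hδ
  have hδn : 0 < δ ^ (d + m) := by positivity
  have hx0 : 0 < 6 * κ * δ := by positivity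
  rcases le_or_gt (6 * κ * δ) 1 with hsmall | hlarge
  · set K : ℕ := ⌊(6 * κ * δ)⁻¹⌋₊ with hKdef
    have hinv1 : 1 ≤ (6 * κ * δ)⁻¹ := (one_le_inv₀ hx0).2 hsmall
    have hK0 : 0 < K := Nat.floor_pos.2 hinv1
    have hK1 : (1 : ℝ) ≤ K := by exact_mod_cast hK0
    have hKle : (K : ℝ) ≤ (6 * κ * δ)⁻¹ := Nat.floor_le (by positivity)
    have hKlt : (6 * κ * δ)⁻¹ < K + 1 := Nat.lt_floor_add_one _
    have hmul : (6 * κ * δ)⁻¹ * (6 * κ * δ) = 1 := inv_mul_cancel₀ hx0.ne'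
    have hKκ : κ * δ * K ≤ 1 / 6 := by
      have := mul_le_mul_of_nonneg_right hKle hx0.le
      linarith
    have hKδ : 1 ≤ 12 * κ * δ * K := by
      have : (6 * κ * δ)⁻¹ * (6 * κ * δ) ≤ (2 * K) * (6 * κ * δ) :=
        mul_le_mul_of_nonneg_right (by linarith) hx0.le
      linarith
    have hKρ : (K : ℝ) ^ ρ ≤ (q : ℝ) ^ d := by
      have h1 : (K : ℝ) ≤ (q : ℝ) ^ ((d : ℝ) / ρ) := by
        refine hKle.trans ?_
        rw [inv_le_comm₀ hx0 (by positivity), ← Real.rpow_neg hq0.le]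
        exact hδ.trans (by nlinarith)
      refine (Real.rpow_le_rpow K.cast_nonneg h1 hρ0.le).trans (le_of_eq ?_)
      rw [← Real.rpow_mul hq0.le, div_mul_cancel₀ _ hρ0.ne', Real.rpow_natCast]
    obtain ⟨s, hs, hvol⟩ := volume_approxSet_le_card α A R q hq hδ0 K hKκ
    have hcard := hC _ _ K hK0 s hs
    have hL : ((2 * ((R + 1) * q) + 1 : ℕ) : ℝ) ≤ (2 * R + 3) * q := by
      push_cast
      linarith
    have hcard' : (s.card : ℝ) * (K : ℝ) ^ m ≤ C * (((2 * R + 3) ^ d + 1) * (q : ℝ) ^ d) := by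
      refine hcard.trans (mul_le_mul_of_nonneg_left ?_ hC0.le)
      have := pow_le_pow_left₀ (Nat.cast_nonneg _) hL d
      rw [mul_pow] at this
      linarith
    have hfin : (s.card : ℝ) ≤
        C * (((2 * R + 3) ^ d + 1) * (q : ℝ) ^ d) * (12 * κ * δ) ^ m := by
      calc (s.card : ℝ) ≤ s.card * (12 * κ * δ * K) ^ m :=
            le_mul_of_one_le_right (Nat.cast_nonneg _) (one_le_pow₀ hKδ)
        _ = (s.card * (K : ℝ) ^ m) * (12 * κ * δ) ^ m := by rw [mul_pow]; ring
        _ ≤ _ := by gcongr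
    refine hvol.trans (ENNReal.ofReal_le_ofReal ?_)
    calc (s.card : ℝ) * (2 * (δ / q)) ^ d
        ≤ C * (((2 * R + 3) ^ d + 1) * (q : ℝ) ^ d) * (12 * κ * δ) ^ m * (2 * (δ / q)) ^ d := by
          gcongr
      _ = C₁ * δ ^ (d + m) := by
          rw [hC₁, mul_pow (12 * κ), mul_pow 2 (δ / (q : ℝ)), div_pow, pow_add]
          field_simp
      _ ≤ (C₁ + C₂) * δ ^ (d + m) := by
          gcongr
          linarith
  · refine (volume_approxSet_le_pow α A R q δ).trans (ENNReal.ofReal_le_ofReal ?_)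
    calc ((2 * R : ℝ)) ^ d ≤ (2 * R) ^ d * (6 * κ * δ) ^ (d + m) :=
          le_mul_of_one_le_right (by positivity) (one_le_pow₀ hlarge.le)
      _ = C₂ * δ ^ (d + m) := by rw [hC₂, mul_pow (6 * κ)]; ring
      _ ≤ (C₁ + C₂) * δ ^ (d + m) := by
          gcongr
          linarith

lemma volume_frequently_approxSet_eq_zero {d m : ℕ} (hd : 0 < d) (α : Fin m → ℝ)
    (A : Matrix (Fin d) (Fin m) ℝ) (hω : multType A < ((d * (d + m) : ℕ) : ℝ≥0∞))
    (ψ : ℕ → ℝ) (hψ : ∀ q, 0 ≤ ψ q) (hsum : Summable fun q => ψ q ^ (d + m)) (R : ℕ) :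
    volume {x | ∃ᶠ q in Filter.atTop, 0 < q ∧ x ∈ approxSet α A R q (ψ q)} = 0 := by
  obtain ⟨ρ, C, hρ0, hρN, hC0, hC⟩ := exists_volume_approxSet_le hd α A hω R
  set τ : ℝ := (d : ℝ) / ρ with hτ
  have hsum' : Summable fun q : ℕ => C * (ψ q ^ (d + m) + (q : ℝ) ^ (-(τ * (d + m : ℕ)))) := by
    refine (hsum.add (Real.summable_nat_rpow.2 ?_)).mul_left C
    rw [neg_lt_neg_iff, hτ, div_mul_eq_mul_div, one_lt_div hρ0]
    exact_mod_cast hρN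
  refine measure_setOfPred_frequently_eq_zero (ne_top_of_le_ne_top hsum'.tsum_ofReal_ne_top
    (ENNReal.tsum_le_tsum fun q => ?_))
  rcases Nat.eq_zero_or_pos q with rfl | hq
  · simp
  have hmono : {x | 0 < q ∧ x ∈ approxSet α A R q (ψ q)} ⊆
      approxSet α A R q (max (ψ q) ((q : ℝ) ^ (-τ))) := fun x hx =>
    ⟨hx.2.1, fun u => lt_max_of_lt_left (hx.2.2.1 u), fun v => lt_max_of_lt_left (hx.2.2.2 v)⟩
  refine (measure_mono hmono).trans ((hC q _ hq (le_max_right _ _)).trans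
    (ENNReal.ofReal_le_ofReal (mul_le_mul_of_nonneg_left ?_ hC0)))
  have h1 : ((q : ℝ) ^ (-τ)) ^ (d + m) = (q : ℝ) ^ (-(τ * (d + m : ℕ))) := by
    rw [← Real.rpow_natCast, ← Real.rpow_mul q.cast_nonneg, neg_mul]
  rw [← h1]
  have h2 : 0 ≤ ψ q ^ (d + m) := pow_nonneg (hψ q) _
  have h3 : 0 ≤ ((q : ℝ) ^ (-τ)) ^ (d + m) := by positivity
  rcases max_choice (ψ q) ((q : ℝ) ^ (-τ)) with h | h <;> rw [h] <;> linarith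

theorem strong_Khintchine_type_for_convergence
    (n d : ℕ) (hd : 1 ≤ d) (hdn : d < n)
    (α₀ : Fin (n - d) → ℝ) (A : Matrix (Fin d) (Fin (n - d)) ℝ)
    (Atil : Matrix (Fin (d + 1)) (Fin (n - d)) ℝ)
    (hAtil : Atil = Matrix.of (Fin.cons α₀ A))
    (hω : multType A < ((d * n : ℕ) : ℝ≥0∞))
    (ψ : ℕ → ℝ) (hψ : ∀ q, 0 ≤ ψ q)
    (hsum : Summable fun q : ℕ => ψ q ^ n) :
    volume {x : Fin d → ℝ |
      {q : ℕ | 0 < q ∧ (∀ i, dNI ((q : ℝ) * x i) < ψ q) ∧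
        (∀ v, dNI ((q : ℝ) * ∑ u, (Fin.cons (1 : ℝ) x : Fin (d+1) → ℝ) u * Atil u v) < ψ q)}.Infinite} = 0 := by
  have hm : d + (n - d) = n := by omega
  have hnull : ∀ R : ℕ, volume {x : Fin d → ℝ |
      ∃ᶠ q in Filter.atTop, 0 < q ∧ x ∈ approxSet α₀ A R q (ψ q)} = 0 := fun R =>
    volume_frequently_approxSet_eq_zero hd α₀ A (by rwa [hm]) ψ hψ (by simpa only [hm]) R
  refine measure_mono_null (fun x hx => ?_) (measure_iUnion_null hnull)
  obtain ⟨R, hR⟩ := exists_nat_ge ‖x‖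
  refine Set.mem_iUnion.2 ⟨R, ?_⟩
  rw [Set.mem_ofPred_eq, Nat.frequently_atTop_iff_infinite]
  refine Set.Infinite.mono (fun q hq => ?_) hx
  obtain ⟨hq0, hqx, hqv⟩ := hq
  refine ⟨hq0, fun u => (norm_le_pi_norm x u).trans hR, hqx, fun v => ?_⟩
  have h := hqv v
  rw [hAtil, Fin.sum_univ_succ] at h
  simp only [Matrix.of_apply, Fin.cons_zero, Fin.cons_succ, one_mul] at h
  exact h
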